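/- arXiv:cs/0701061 — 4 statements merged into one kernel-verified Lean document; each statement's English description precedes it below -/
import Mathlib

section
/- Let A ∈ ℂ^{n×n} be Hermitian with spectral decomposition A = U diag(λ₁,…,λₙ) U†, and let A₊ = U diag(max{λᵢ,0}) U†. Then A₊ is the projection of A onto the positive semidefinite cone in Frobenius norm: for every Hermitian positive semidefinite matrix B ∈ ℂ^{n×n}, ‖A − A₊‖_F ≤ ‖A − B‖_F, with equality only if B = A₊. -/
open Matrix ComplexOrder

/-- The Frobenius norm of a complex matrix: `‖M‖_F = (Tr(M† M))^{1/2}`. -/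
noncomputable def frobNorm {n : ℕ} (M : Matrix (Fin n) (Fin n) ℂ) : ℝ :=
  Real.sqrt (Matrix.trace (Mᴴ * M)).re

theorem trace_conjTranspose_mul_self_re {n : ℕ} (M : Matrix (Fin n) (Fin n) ℂ) :
    (Matrix.trace (Mᴴ * M)).re = ∑ j, ∑ i, Complex.normSq (M i j) := by
  simp [Matrix.trace, Matrix.mul_apply, Complex.normSq_apply]

theorem frobNorm_eq_sqrt_sum {n : ℕ} (M : Matrix (Fin n) (Fin n) ℂ) :
    frobNorm M = Real.sqrt (∑ j, ∑ i, Complex.normSq (M i j)) := by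
  rw [frobNorm, trace_conjTranspose_mul_self_re]

theorem frobNorm_unitary_conj {n : ℕ} {U : Matrix (Fin n) (Fin n) ℂ}
    (hU : U ∈ Matrix.unitaryGroup (Fin n) ℂ) (M : Matrix (Fin n) (Fin n) ℂ) :
    frobNorm (U * M * Uᴴ) = frobNorm M := by
  have h : Uᴴ * U = 1 := Matrix.mem_unitaryGroup_iff'.mp hU
  have key : (U * M * Uᴴ)ᴴ * (U * M * Uᴴ) = U * (Mᴴ * M) * Uᴴ := by
    calc (U * M * Uᴴ)ᴴ * (U * M * Uᴴ) = U * Mᴴ * (Uᴴ * U) * M * Uᴴ := by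
          simp only [Matrix.conjTranspose_mul, Matrix.conjTranspose_conjTranspose,
            Matrix.mul_assoc]
      _ = U * (Mᴴ * M) * Uᴴ := by rw [h, Matrix.mul_one, Matrix.mul_assoc U]
  rw [frobNorm, frobNorm, key, Matrix.trace_mul_comm, ← Matrix.mul_assoc, h, Matrix.one_mul]

/-- The obtuse-angle inequality for the projection of a real diagonal matrix onto the positive
semidefinite cone, entry by entry. -/
theorem normSq_diagonal_posPart_le {n : ℕ} (l : Fin n → ℝ)
    {C : Matrix (Fin n) (Fin n) ℂ} (hC : C.PosSemidef) (i j : Fin n) :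
    Complex.normSq ((Matrix.diagonal (fun i => Complex.ofReal (l i))
          - Matrix.diagonal (fun i => Complex.ofReal (max (l i) 0))) i j)
        + Complex.normSq ((C - Matrix.diagonal (fun i => Complex.ofReal (max (l i) 0))) i j)
      ≤ Complex.normSq ((Matrix.diagonal (fun i => Complex.ofReal (l i)) - C) i j) := by
  rcases eq_or_ne i j with rfl | hij
  · have hc := (Complex.nonneg_iff.mp (hC.diag_nonneg (i := i))).1
    simp only [Matrix.sub_apply, Matrix.diagonal_apply_eq, Complex.normSq_apply, Complex.sub_re,
      Complex.sub_im, Complex.ofReal_re, Complex.ofReal_im]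
    rcases le_total (l i) 0 with h | h
    · rw [max_eq_right h]
      nlinarith [mul_nonneg (neg_nonneg.mpr h) hc]
    · rw [max_eq_left h]
      exact le_of_eq (by ring)
  · simp [Matrix.diagonal_apply_ne _ hij]

theorem frobNorm_diagonal_posPart_le {n : ℕ} (l : Fin n → ℝ)
    {C : Matrix (Fin n) (Fin n) ℂ} (hC : C.PosSemidef) :
    frobNorm (Matrix.diagonal (fun i => Complex.ofReal (l i))
          - Matrix.diagonal (fun i => Complex.ofReal (max (l i) 0)))
        ≤ frobNorm (Matrix.diagonal (fun i => Complex.ofReal (l i)) - C) ∧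
      (frobNorm (Matrix.diagonal (fun i => Complex.ofReal (l i))
          - Matrix.diagonal (fun i => Complex.ofReal (max (l i) 0)))
          = frobNorm (Matrix.diagonal (fun i => Complex.ofReal (l i)) - C) →
        C = Matrix.diagonal (fun i => Complex.ofReal (max (l i) 0))) := by
  have key := Finset.sum_le_sum fun j (_ : j ∈ Finset.univ) =>
    Finset.sum_le_sum fun i (_ : i ∈ Finset.univ) => normSq_diagonal_posPart_le l hC i j
  simp only [Finset.sum_add_distrib] at key
  have nonneg : ∀ M : Matrix (Fin n) (Fin n) ℂ, 0 ≤ ∑ j, ∑ i, Complex.normSq (M i j) :=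
    fun M => Finset.sum_nonneg fun j _ => Finset.sum_nonneg fun i _ => Complex.normSq_nonneg _
  have hpos := nonneg (C - Matrix.diagonal (fun i => Complex.ofReal (max (l i) 0)))
  simp only [frobNorm_eq_sqrt_sum]
  refine ⟨Real.sqrt_le_sqrt (by linarith), fun h => ?_⟩
  rw [Real.sqrt_inj (nonneg _) (nonneg _)] at h
  have hzero : ∑ j, ∑ i, Complex.normSq
      ((C - Matrix.diagonal (fun i => Complex.ofReal (max (l i) 0))) i j) = 0 := by linarith
  rw [Finset.sum_eq_zero_iff_of_nonneg
    fun j _ => Finset.sum_nonneg fun i _ => Complex.normSq_nonneg _] at hzero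
  ext i j
  have hj := hzero j (Finset.mem_univ j)
  rw [Finset.sum_eq_zero_iff_of_nonneg fun i _ => Complex.normSq_nonneg _] at hj
  exact sub_eq_zero.mp (Complex.normSq_eq_zero.mp (hj i (Finset.mem_univ i)))

/-- Let `A` be Hermitian with spectral decomposition `A = U diag(λ₁,…,λₙ) U†` and let
`A₊ = U diag(max{λᵢ,0}) U†`. Then `A₊` is the projection of `A` onto the positive
semidefinite cone in Frobenius norm: for every Hermitian positive semidefinite `B`,
`‖A − A₊‖_F ≤ ‖A − B‖_F`, with equality only if `B = A₊`. -/
theorem posPart_is_psd_projection {n : ℕ} (A U : Matrix (Fin n) (Fin n) ℂ)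
    (l : Fin n → ℝ) (hU : U ∈ Matrix.unitaryGroup (Fin n) ℂ)
    (hA : A = U * Matrix.diagonal (fun i => Complex.ofReal (l i)) * Uᴴ)
    (B : Matrix (Fin n) (Fin n) ℂ) (hB : B.PosSemidef) :
    frobNorm (A - U * Matrix.diagonal (fun i => Complex.ofReal (max (l i) 0)) * Uᴴ)
      ≤ frobNorm (A - B) ∧
    (frobNorm (A - U * Matrix.diagonal (fun i => Complex.ofReal (max (l i) 0)) * Uᴴ)
        = frobNorm (A - B) →
      B = U * Matrix.diagonal (fun i => Complex.ofReal (max (l i) 0)) * Uᴴ) := by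
  have hUU : U * Uᴴ = 1 := Matrix.mem_unitaryGroup_iff.mp hU
  obtain ⟨C, hC, rfl⟩ : ∃ C : Matrix (Fin n) (Fin n) ℂ, C.PosSemidef ∧ B = U * C * Uᴴ := by
    refine ⟨Uᴴ * B * U, hB.conjTranspose_mul_mul_same U, ?_⟩
    calc B = (U * Uᴴ) * B * (U * Uᴴ) := by rw [hUU, Matrix.one_mul, Matrix.mul_one]
      _ = U * (Uᴴ * B * U) * Uᴴ := by simp only [Matrix.mul_assoc]
  subst hA
  simp only [← Matrix.sub_mul, ← Matrix.mul_sub, frobNorm_unitary_conj hU]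
  obtain ⟨hle, heq⟩ := frobNorm_diagonal_posPart_le l hC
  exact ⟨hle, fun h => by rw [heq h]⟩
end

section
/- Let A ∈ ℂ^{n×n} be Hermitian with spectral decomposition A = U diag(λ₁,…,λₙ) U†, and let A₋ = U diag(min{λᵢ,0}) U†. Then A₋ is the projection of A onto the negative semidefinite cone in Frobenius norm: for every Hermitian negative semidefinite matrix B ∈ ℂ^{n×n}, ‖A − A₋‖_F ≤ ‖A − B‖_F, with equality only if B = A₋. -/
open Matrix ComplexOrder

theorem frobNorm_sq {n : ℕ} (M : Matrix (Fin n) (Fin n) ℂ) :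
    frobNorm M ^ 2 = (trace (Mᴴ * M)).re :=
  Real.sq_sqrt (Complex.nonneg_iff.mp (posSemidef_conjTranspose_mul_self M).trace_nonneg).1

theorem frobNorm_nonneg {n : ℕ} (M : Matrix (Fin n) (Fin n) ℂ) : 0 ≤ frobNorm M :=
  Real.sqrt_nonneg _

theorem eq_zero_of_frobNorm_eq_zero {n : ℕ} {M : Matrix (Fin n) (Fin n) ℂ}
    (h : frobNorm M = 0) : M = 0 := by
  have htrace := Complex.nonneg_iff.mp (posSemidef_conjTranspose_mul_self M).trace_nonneg
  have hre : (trace (Mᴴ * M)).re = 0 := by rw [← frobNorm_sq, h]; simp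
  exact trace_conjTranspose_mul_self_eq_zero_iff.mp (Complex.ext hre htrace.2.symm)

theorem frobNorm_add_sq {n : ℕ} {P : Matrix (Fin n) (Fin n) ℂ} (hP : P.IsHermitian)
    (D : Matrix (Fin n) (Fin n) ℂ) :
    frobNorm (P + D) ^ 2 = frobNorm P ^ 2 + frobNorm D ^ 2 + 2 * (trace (P * D)).re := by
  have hconj : (trace (Dᴴ * P)).re = (trace (P * D)).re := by
    have h : Dᴴ * P = (P * D)ᴴ := by rw [conjTranspose_mul, hP.eq]
    rw [h, trace_conjTranspose]
    simp
  simp only [frobNorm_sq, conjTranspose_add, hP.eq, add_mul, mul_add, trace_add, Complex.add_re,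
    hconj]
  ring

theorem trace_unitary_conj_diagonal_mul_re_nonneg {n : ℕ} (U : Matrix (Fin n) (Fin n) ℂ)
    {p : Fin n → ℝ} (hp : ∀ i, 0 ≤ p i) {C : Matrix (Fin n) (Fin n) ℂ} (hC : C.PosSemidef) :
    0 ≤ (trace (U * diagonal (fun i => Complex.ofReal (p i)) * Uᴴ * C)).re := by
  have hcycle : trace (U * diagonal (fun i => Complex.ofReal (p i)) * Uᴴ * C)
      = trace (diagonal (fun i => Complex.ofReal (p i)) * (Uᴴ * C * U)) := by
    rw [mul_assoc, mul_assoc, trace_mul_comm]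
    simp only [mul_assoc]
  rw [hcycle, trace, Complex.re_sum]
  refine Finset.sum_nonneg fun i _ => ?_
  rw [diag_apply, diagonal_mul, Complex.re_ofReal_mul]
  have hdiag : 0 ≤ (Uᴴ * C * U) i i := (hC.conjTranspose_mul_mul_same U).diag_nonneg
  exact mul_nonneg (hp i) (Complex.nonneg_iff.mp hdiag).1

/-- Let `A` be Hermitian with spectral decomposition `A = U diag(λ₁,…,λₙ) U†` and let
`A₋ = U diag(min{λᵢ,0}) U†`. Then `A₋` is the projection of `A` onto the negative
semidefinite cone in Frobenius norm: for every Hermitian negative semidefinite `B`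
(i.e. `-B` positive semidefinite), `‖A − A₋‖_F ≤ ‖A − B‖_F`, with equality only if
`B = A₋`. -/
theorem negPart_is_nsd_projection {n : ℕ} (A U : Matrix (Fin n) (Fin n) ℂ)
    (l : Fin n → ℝ) (hU : U ∈ Matrix.unitaryGroup (Fin n) ℂ)
    (hA : A = U * Matrix.diagonal (fun i => Complex.ofReal (l i)) * Uᴴ)
    (B : Matrix (Fin n) (Fin n) ℂ) (hB : (-B).PosSemidef) :
    frobNorm (A - U * Matrix.diagonal (fun i => Complex.ofReal (min (l i) 0)) * Uᴴ)
      ≤ frobNorm (A - B) ∧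
    (frobNorm (A - U * Matrix.diagonal (fun i => Complex.ofReal (min (l i) 0)) * Uᴴ)
        = frobNorm (A - B) →
      B = U * Matrix.diagonal (fun i => Complex.ofReal (min (l i) 0)) * Uᴴ) := by
  set N := U * diagonal (fun i => Complex.ofReal (min (l i) 0)) * Uᴴ with hN
  set P := U * diagonal (fun i => Complex.ofReal (max (l i) 0)) * Uᴴ with hP
  have hUU : Uᴴ * U = 1 := mem_unitaryGroup_iff'.mp hU
  have hAN : A = P + N := by
    rw [hA, hP, hN, ← add_mul, ← mul_add, diagonal_add]
    simp only [← Complex.ofReal_add, max_add_min, add_zero]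
  have hPN : P * N = 0 := by
    have hassoc : P * N = U * (diagonal (fun i => Complex.ofReal (max (l i) 0)) * (Uᴴ * U) *
        diagonal (fun i => Complex.ofReal (min (l i) 0))) * Uᴴ := by
      simp only [hP, hN, mul_assoc]
    rw [hassoc, hUU, mul_one, diagonal_mul_diagonal]
    simp [← Complex.ofReal_mul, max_mul_min]
  have hPherm : P.IsHermitian := by
    refine isHermitian_mul_mul_conjTranspose U (isHermitian_diagonal_of_self_adjoint _ ?_)
    ext i
    simp
  have hcross : 0 ≤ (trace (P * (N - B))).re := by
    rw [sub_eq_add_neg, mul_add, hPN, zero_add]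
    exact trace_unitary_conj_diagonal_mul_re_nonneg U (fun i => le_max_right (l i) 0) hB
  have hexpand := frobNorm_add_sq hPherm (N - B)
  rw [show A - N = P by rw [hAN]; abel, show A - B = P + (N - B) by rw [hAN]; abel]
  refine ⟨?_, fun heq => ?_⟩
  · refine (sq_le_sq₀ (frobNorm_nonneg _) (frobNorm_nonneg _)).mp ?_
    linarith [sq_nonneg (frobNorm (N - B))]
  · rw [← heq] at hexpand
    have hzero : frobNorm (N - B) = 0 :=
      pow_eq_zero_iff two_ne_zero |>.mp (le_antisymm (by linarith) (sq_nonneg _))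
    exact (sub_eq_zero.mp (eq_zero_of_frobNorm_eq_zero hzero)).symm
end

section
/- Let λ₁ ≥ λ₂ ≥ … ≥ λₙ be real numbers, P, c ∈ ℝ, and ψ(μ) = −½ Σ_{j=1}^{n} (max{0, λⱼ − μ})² − μP + c. Fix an index Î with 1 ≤ Î ≤ n and set μ*_Î = (Σ_{i=1}^{Î} λᵢ − P)/Î. If μ*_Î ≥ 0 and λ_{Î+1} ≤ μ*_Î ≤ λ_{Î} (where λ_{n+1} := −∞), then μ*_Î is a global maximizer of ψ over [0, ∞): ψ(μ*_Î) ≥ ψ(μ) for every μ ≥ 0. -/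
/-- The tangent-line inequality for the convex function `x ↦ (max 0 (a - x)) ^ 2`. -/
lemma sq_max_zero_sub_tangent_le (a x y : ℝ) :
    (max 0 (a - x)) ^ 2 - 2 * (y - x) * max 0 (a - x) ≤ (max 0 (a - y)) ^ 2 := by
  rcases max_cases 0 (a - x) with ⟨hx, _⟩ | ⟨hx, _⟩ <;>
    rcases max_cases 0 (a - y) with ⟨hy, _⟩ | ⟨hy, _⟩ <;> rw [hx, hy] <;>
    nlinarith [sq_nonneg (x - y)]

/-- If the first `I` terms of `l` are at least `x` and the remaining ones at most `x`, then the
positive parts of `l j - x` are supported on the first `I` indices. -/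
lemma sum_max_zero_sub_eq {n I : ℕ} {l : ℕ → ℝ} {x : ℝ} (hIn : I ≤ n)
    (hhi : ∀ j ∈ Finset.Icc 1 I, x ≤ l j) (hlo : ∀ j, I < j → j ≤ n → l j ≤ x) :
    ∑ j ∈ Finset.Icc 1 n, max 0 (l j - x) = (∑ j ∈ Finset.Icc 1 I, l j) - I * x := by
  have h : ∑ j ∈ Finset.Icc 1 I, max 0 (l j - x) = ∑ j ∈ Finset.Icc 1 n, max 0 (l j - x) := by
    refine Finset.sum_subset (Finset.Icc_subset_Icc_right hIn) fun j hj hjI => ?_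
    rw [Finset.mem_Icc] at hj hjI
    exact max_eq_left (sub_nonpos.2 (hlo j (by lia) hj.2))
  rw [← h, Finset.sum_congr rfl fun j hj => max_eq_right (sub_nonneg.2 (hhi j hj))]
  simp

/-- Let `λ₁ ≥ … ≥ λₙ` be reals, `P, c ∈ ℝ`, and
`ψ(μ) = −½ Σ_{j=1}^{n} (max{0, λⱼ − μ})² − μP + c`. Fix `Î` with `1 ≤ Î ≤ n` and set
`μ*_Î = (Σ_{i=1}^{Î} λᵢ − P)/Î`. If `μ*_Î ≥ 0` and `λ_{Î+1} ≤ μ*_Î ≤ λ_Î`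
(the lower bound being vacuous when `Î = n`), then `μ*_Î` is a global maximizer of `ψ`
over `[0, ∞)`. -/
theorem psi_global_maximizer (n : ℕ) (l : ℕ → ℝ) (P c : ℝ)
    (hsort : ∀ i j : ℕ, 1 ≤ i → i ≤ j → j ≤ n → l j ≤ l i)
    (I : ℕ) (hI1 : 1 ≤ I) (hIn : I ≤ n)
    (μstar : ℝ) (hμstar : μstar = ((∑ i ∈ Finset.Icc 1 I, l i) - P) / (I : ℝ))
    (hge : 0 ≤ μstar) (hlo : I < n → l (I + 1) ≤ μstar) (hhi : μstar ≤ l I) :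
    ∀ μ : ℝ, 0 ≤ μ →
      -(1/2) * ∑ j ∈ Finset.Icc 1 n, (max 0 (l j - μ)) ^ 2 - μ * P + c
        ≤ -(1/2) * ∑ j ∈ Finset.Icc 1 n, (max 0 (l j - μstar)) ^ 2 - μstar * P + c := by
  intro μ _
  have hI : (I : ℝ) ≠ 0 := by positivity
  have hP : ∑ j ∈ Finset.Icc 1 n, max 0 (l j - μstar) = P := by
    rw [sum_max_zero_sub_eq hIn, hμstar, mul_div_cancel₀ _ hI]
    · ring
    · intro j hj
      rw [Finset.mem_Icc] at hj
      exact hhi.trans (hsort j I hj.1 hj.2 hIn)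
    · intro j hIj hjn
      exact (hsort (I + 1) j (by lia) hIj hjn).trans (hlo (hIj.trans_le hjn))
  have h := Finset.sum_le_sum fun j (_ : j ∈ Finset.Icc 1 n) =>
    sq_max_zero_sub_tangent_le (l j) μstar μ
  rw [Finset.sum_sub_distrib, ← Finset.mul_sum, hP] at h
  linarith
end

section
/- (Weak duality for the projection problem) Let D ∈ ℂ^{n×n} be Hermitian with eigenvalues λ₁,…,λₙ, let P > 0, and let ψ(μ) = −½ Σ_{j=1}^{n} (max{0, λⱼ − μ})² − μP + ½‖D‖_F². Then for every μ ≥ 0 and every Hermitian positive semidefinite matrix D̃ ∈ ℂ^{n×n} with Re Tr(D̃) ≤ P, one has ψ(μ) ≤ ½‖D̃ − D‖_F². -/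
open Matrix ComplexOrder

theorem frobNorm_sq_eq_sum {n : ℕ} (M : Matrix (Fin n) (Fin n) ℂ) :
    frobNorm M ^ 2 = ∑ i, ∑ j, ‖M i j‖ ^ 2 := by
  have h : (Matrix.trace (Mᴴ * M)).re = ∑ i, ∑ j, ‖M i j‖ ^ 2 := by
    rw [Finset.sum_comm]
    simp only [Matrix.trace, Matrix.diag_apply, Matrix.mul_apply, Matrix.conjTranspose_apply,
      Complex.re_sum, RCLike.star_def, Complex.conj_mul', ← Complex.ofReal_pow, Complex.ofReal_re]
  rw [frobNorm, Real.sq_sqrt (h ▸ by positivity), h]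

theorem sum_re_diag_sq_le_frobNorm_sq {n : ℕ} (M : Matrix (Fin n) (Fin n) ℂ) :
    ∑ i, (M i i).re ^ 2 ≤ frobNorm M ^ 2 := by
  rw [frobNorm_sq_eq_sum]
  refine Finset.sum_le_sum fun i _ => ?_
  calc (M i i).re ^ 2 ≤ ‖M i i‖ ^ 2 := sq_le_sq.mpr (by simpa using Complex.abs_re_le_norm (M i i))
    _ ≤ ∑ j, ‖M i j‖ ^ 2 :=
      Finset.single_le_sum (f := fun j => ‖M i j‖ ^ 2) (fun j _ => by positivity)
        (Finset.mem_univ i)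

theorem frobNorm_diagonal_ofReal_sq {n : ℕ} (l : Fin n → ℝ) :
    frobNorm (Matrix.diagonal fun i => Complex.ofReal (l i)) ^ 2 = ∑ i, l i ^ 2 := by
  simp [frobNorm_sq_eq_sum, Matrix.diagonal_apply, apply_ite (fun z : ℂ => ‖z‖ ^ 2)]

theorem scalar_dual_bound {x : ℝ} (hx : 0 ≤ x) (a μ : ℝ) :
    -(1/2) * (max 0 (a - μ)) ^ 2 - μ * x + (1/2) * a ^ 2 ≤ (1/2) * (x - a) ^ 2 := by
  nlinarith [sq_nonneg (x - max 0 (a - μ)), mul_le_mul_of_nonneg_left (le_max_right 0 (a - μ)) hx]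

/-- **Weak duality for the projection problem.** Let `D` be Hermitian with eigenvalues
`λ₁,…,λₙ` (i.e. `D = U diag(λ) U†` for a unitary `U`), `P > 0`, and
`ψ(μ) = −½ Σⱼ (max{0, λⱼ − μ})² − μP + ½‖D‖_F²`. Then for every `μ ≥ 0` and every
Hermitian positive semidefinite `D̃` with `Re Tr(D̃) ≤ P`, `ψ(μ) ≤ ½‖D̃ − D‖_F²`. -/
theorem weak_duality_projection {n : ℕ} (D U : Matrix (Fin n) (Fin n) ℂ)
    (l : Fin n → ℝ) (hU : U ∈ Matrix.unitaryGroup (Fin n) ℂ)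
    (hD : D = U * Matrix.diagonal (fun i => Complex.ofReal (l i)) * Uᴴ)
    (P : ℝ) (hP : 0 < P) (μ : ℝ) (hμ : 0 ≤ μ)
    (Dt : Matrix (Fin n) (Fin n) ℂ) (hDt : Dt.PosSemidef)
    (htr : (Matrix.trace Dt).re ≤ P) :
    -(1/2) * ∑ j : Fin n, (max 0 (l j - μ)) ^ 2 - μ * P + (1/2) * frobNorm D ^ 2
      ≤ (1/2) * frobNorm (Dt - D) ^ 2 := by
  have hU' : U * Uᴴ = 1 := Matrix.mem_unitaryGroup_iff.mp hU
  set L := Matrix.diagonal fun i => Complex.ofReal (l i) with hL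
  set X := Uᴴ * Dt * U with hX
  have hDtX : Dt = U * X * Uᴴ := by
    calc Dt = (U * Uᴴ) * Dt * (U * Uᴴ) := by rw [hU', Matrix.one_mul, Matrix.mul_one]
      _ = U * X * Uᴴ := by simp only [hX, Matrix.mul_assoc]
  have hsub : frobNorm (Dt - D) = frobNorm (X - L) := by
    rw [← frobNorm_unitary_conj hU (X - L), Matrix.mul_sub, Matrix.sub_mul, ← hDtX, ← hD]
  have hnormD : frobNorm D ^ 2 = ∑ i, l i ^ 2 := by
    rw [hD, frobNorm_unitary_conj hU, hL, frobNorm_diagonal_ofReal_sq]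
  have hdiag : ∀ i, 0 ≤ (X i i).re := fun i =>
    (Complex.le_def.mp (hDt.conjTranspose_mul_mul_same U).diag_nonneg).1
  have htrX : ∑ i, (X i i).re ≤ P := by
    have h : Matrix.trace X = Matrix.trace Dt := by
      rw [hX, Matrix.mul_assoc, Matrix.trace_mul_comm, Matrix.mul_assoc, hU', Matrix.mul_one]
    rw [← h] at htr
    simpa [Matrix.trace] using htr
  have hentry : ∑ i, ((X i i).re - l i) ^ 2 ≤ frobNorm (X - L) ^ 2 := by
    simpa [hL] using sum_re_diag_sq_le_frobNorm_sq (X - L)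
  have hscalar := Finset.sum_le_sum fun i (_ : i ∈ Finset.univ) =>
    scalar_dual_bound (hdiag i) (l i) μ
  simp only [Finset.sum_add_distrib, Finset.sum_sub_distrib, ← Finset.mul_sum] at hscalar
  rw [hsub, hnormD]
  linarith [mul_le_mul_of_nonneg_left htrX hμ]
end
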